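/- Fix an integer d ≥ 3 and reals h,γ > 0. There exist constants C₁, C₂ > 0 and ε₀ > 0 (depending only on d, h, γ) such that for every ε ∈ (0,ε₀), every c ∈ (0,1], every sufficiently large n, every pair of graphs G, H on n vertices satisfying the hypotheses, every family M of bijections, and every integral solution f of 𝓘(X(G,H,M)) with cost at most c·ε²·n²·(log n)^{2/3}, the following holds. Call g ∈ V_G a good cloud if there exists v ∈ X such that |{h ∈ V_H : f((g,h)) = v_T}| ≥ (1−C₁·ε)·|V_H| and the shortest path in G between g and π(v) has at most ε·log n edges. Then the number of good clouds is at least (1 − C₂·c·ε)·n. -/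

import Mathlib

open Finset

noncomputable section

/-- A semi-metric on a type `V`. -/
def IsSemiMetric {V : Type} (δ : V → V → ℝ) : Prop :=
  (∀ u v, 0 ≤ δ u v) ∧ (∀ u, δ u u = 0) ∧ (∀ u v, δ u v = δ v u) ∧
    ∀ u v w, δ u w ≤ δ u v + δ v w

/-- The length of a walk with respect to edge lengths `ℓ`. -/
def walkCost {V : Type} {Gr : SimpleGraph V} (ℓ : Sym2 V → ℝ) {u v : V} (p : Gr.Walk u v) : ℝ :=
  (p.edges.map ℓ).sum

/-- The shortest-path (semi-)metric of the graph `Gr` with edge lengths `ℓ`. -/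
def spDist {V : Type} (Gr : SimpleGraph V) (ℓ : Sym2 V → ℝ) (u v : V) : ℝ :=
  sInf {r : ℝ | ∃ p : Gr.Walk u v, r = walkCost ℓ p}

/-- `EO` is an orientation of the edges of `G`: it consists of ordered pairs of adjacent
vertices and contains exactly one of the two orientations of every edge of `G`. -/
def IsOrientation {V : Type} (G : SimpleGraph V) (EO : Finset (V × V)) : Prop :=
  (∀ p ∈ EO, G.Adj p.1 p.2) ∧ ∀ a b : V, G.Adj a b → ((a, b) ∈ EO ↔ (b, a) ∉ EO)

variable {VG VH : Type}

/-- The defining relation of the extension graph `X(G,H,M)`: intra-cloud edges coming from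
`H`, and inter-cloud matching edges determined by the bijections `M_e`, `e ∈ EG`. -/
def ExtRel (H : SimpleGraph VH) (EG : Finset (VG × VG)) (M : VG × VG → VH ≃ VH) :
    VG × VH → VG × VH → Prop := fun x y =>
  (x.1 = y.1 ∧ H.Adj x.2 y.2) ∨ ((x.1, y.1) ∈ EG ∧ y.2 = M (x.1, y.1) x.2)

/-- The extension graph `X(G,H,M)` on the vertex set `V_G × V_H`. -/
def ExtGraph (H : SimpleGraph VH) (EG : Finset (VG × VG)) (M : VG × VG → VH ≃ VH) :
    SimpleGraph (VG × VH) := SimpleGraph.fromRel (ExtRel H EG M)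

/-- Edge lengths on `X(G,H,M)`: intra-cloud edges have length `(log n)^{1/3}` and
inter-cloud edges have length `(log n)^{2/3}`. -/
def extLen (n : ℕ) [DecidableEq VG] : Sym2 (VG × VH) → ℝ := fun e =>
  if (Sym2.map Prod.fst e).IsDiag then Real.log n ^ ((1 : ℝ) / 3)
  else Real.log n ^ ((2 : ℝ) / 3)

/-- `D_X`, the shortest-path metric of the extension graph `X(G,H,M)`. -/
def extDist (n : ℕ) [DecidableEq VG] (H : SimpleGraph VH) (EG : Finset (VG × VG))
    (M : VG × VG → VH ≃ VH) : VG × VH → VG × VH → ℝ :=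
  spDist (ExtGraph H EG M) (extLen n)

/-- The vertex set of the `0-Extension` instance `𝓘(X)`: the vertices of `X` (`Sum.inl`)
together with a disjoint copy serving as terminals (`Sum.inr`). -/
abbrev IV (VG VH : Type) : Type := (VG × VH) ⊕ (VG × VH)

/-- The edges of the instance graph `𝒢` of `𝓘(X)`, as oriented pairs: intra-cloud edges
(from an orientation `EH` of `H`), inter-cloud matching edges (from an orientation `EG` of
`G` and the bijections `M`), and the pendant edges `(v, v_T)`. -/
def instEdges [Fintype VG] [Fintype VH] [DecidableEq VG] [DecidableEq VH]
    (EH : Finset (VH × VH)) (EG : Finset (VG × VG)) (M : VG × VG → VH ≃ VH) :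
    Finset (IV VG VH × IV VG VH) :=
  ((Finset.univ ×ˢ EH).image fun p => (Sum.inl (p.1, p.2.1), Sum.inl (p.1, p.2.2))) ∪
    ((EG ×ˢ (Finset.univ : Finset VH)).image fun p =>
      (Sum.inl (p.1.1, p.2), Sum.inl (p.1.2, M p.1 p.2))) ∪
    ((Finset.univ : Finset (VG × VH)).image fun x => (Sum.inl x, Sum.inr x))

/-- The edge weights of `𝓘(X)`: every edge of `X` has weight the reciprocal of its
length, and pendant edges have weight `1/L` with `L = log n`. -/
def instW (n : ℕ) [DecidableEq VG] : IV VG VH × IV VG VH → ℝ := fun p =>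
  match p with
  | (Sum.inl x, Sum.inl y) =>
      if x.1 = y.1 then (Real.log n ^ ((1 : ℝ) / 3))⁻¹ else (Real.log n ^ ((2 : ℝ) / 3))⁻¹
  | (Sum.inl _, Sum.inr _) => (Real.log n)⁻¹
  | _ => 0

/-- The metric on the terminals of `𝓘(X)`: `D(u_T, v_T) = D_X(u,v) + 2L` for `u ≠ v`,
with `L = log n` (extended by `0` on non-terminal arguments). -/
def instD (n : ℕ) [DecidableEq VG] [DecidableEq VH] (H : SimpleGraph VH)
    (EG : Finset (VG × VG)) (M : VG × VG → VH ≃ VH) : IV VG VH → IV VG VH → ℝ := fun a b =>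
  match a, b with
  | Sum.inr u, Sum.inr v =>
      if u = v then 0 else extDist n H EG M u v + 2 * Real.log n
  | _, _ => 0

/-- An integral solution of `𝓘(X)`: a map into the terminals fixing every terminal. -/
def IsIntegralSolution {VG VH : Type} (f : IV VG VH → IV VG VH) : Prop :=
  (∀ v : IV VG VH, ∃ x : VG × VH, f v = Sum.inr x) ∧
    ∀ x : VG × VH, f (Sum.inr x) = Sum.inr x

/-- The cost of an integral solution `f` of `𝓘(X)`. -/
def intCost (n : ℕ) [Fintype VG] [Fintype VH] [DecidableEq VG] [DecidableEq VH]
    (H : SimpleGraph VH) (EH : Finset (VH × VH)) (EG : Finset (VG × VG))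
    (M : VG × VG → VH ≃ VH) (f : IV VG VH → IV VG VH) : ℝ :=
  ∑ p ∈ instEdges EH EG M, instW n p * instD n H EG M (f p.1) (f p.2)

/-- `G` is a Cayley graph of the group `Γ` with respect to `d` generators. -/
def IsCayley {Γ : Type} [Group Γ] (G : SimpleGraph Γ) (d : ℕ) : Prop :=
  ∃ S : Finset Γ, S.card = d ∧ (1 : Γ) ∉ S ∧ (∀ s ∈ S, s⁻¹ ∈ S) ∧
    ∀ a b : Γ, G.Adj a b ↔ a⁻¹ * b ∈ S

/-- Every cycle of `G` has length at least `g`. -/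
def GirthAtLeast {V : Type} (G : SimpleGraph V) (g : ℝ) : Prop :=
  ∀ (v : V) (c : G.Walk v v), c.IsCycle → g ≤ (c.length : ℝ)

/-- `G` has edge expansion at least `h`: every `S` with `|S| ≤ |V|/2` has at least `h·|S|`
edges leaving it (counted as ordered pairs `(u,v)`, `u ∈ S`, `v ∉ S`, `u ~ v`, which
counts each leaving edge exactly once). -/
def EdgeExpansionAtLeast {V : Type} [Fintype V] (G : SimpleGraph V) (h : ℝ) : Prop :=
  ∀ S : Finset V, 2 * S.card ≤ Fintype.card V →
    h * (S.card : ℝ) ≤ ({p : V × V | G.Adj p.1 p.2 ∧ p.1 ∈ S ∧ p.2 ∉ S}.ncard : ℝ)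

/-- The hypotheses on the pair `(G, H)`: both are connected `d`-regular Cayley graphs on
`n` vertices with edge expansion at least `h` and girth at least `γ·log n`. -/
def GoodPair (d : ℕ) (h γ : ℝ) (n : ℕ) {VG VH : Type} [Fintype VG] [Fintype VH]
    [Group VG] [Group VH] (G : SimpleGraph VG) (H : SimpleGraph VH) : Prop :=
  Fintype.card VG = n ∧ Fintype.card VH = n ∧ G.Connected ∧ H.Connected ∧
    (∀ v, (G.neighborSet v).ncard = d) ∧ (∀ v, (H.neighborSet v).ncard = d) ∧
    IsCayley G d ∧ IsCayley H d ∧ EdgeExpansionAtLeast G h ∧ EdgeExpansionAtLeast H h ∧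
    GirthAtLeast G (γ * Real.log n) ∧ GirthAtLeast H (γ * Real.log n)

section Split

variable {VG VH : Type}

/-- The multiset of edges of `G` obtained by projecting a walk of the extension graph to
the graph `G` via `π = Prod.fst` (intra-cloud steps project to loops and are dropped). -/
def projEdges [DecidableEq VG] {X : SimpleGraph (VG × VH)} {a b : VG × VH}
    (p : X.Walk a b) : Multiset (Sym2 VG) :=
  Multiset.filter (fun e => ¬ e.IsDiag)
    (Multiset.map (Sym2.map Prod.fst) (p.edges : Multiset (Sym2 (VG × VH))))

/-- Given, for every edge of a subgraph `G'` of `G`, a multiset of edges of `G`, the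
combined multiset collected along a walk of `G` all of whose edges lie in `G'`. -/
def combinedEdges {V : Type} {G : SimpleGraph V} {G' : G.Subgraph}
    (Q : ∀ {a b : V}, G'.Adj a b → Multiset (Sym2 V)) :
    {u v : V} → (c : G.Walk u v) → (∀ e ∈ c.edges, e ∈ G'.edgeSet) → Multiset (Sym2 V)
  | _, _, SimpleGraph.Walk.nil, _ => 0
  | _, _, @SimpleGraph.Walk.cons _ _ u v w _ p, hmem =>
      Q (SimpleGraph.Subgraph.mem_edgeSet.mp (hmem s(u, v) (by simp))) +
        combinedEdges Q p (fun e he => hmem e (by simp [he]))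

/-- `(f̃, P)` (encoded by the multisets `Q` of edges of the walks `P(e)`) is a
cycle-homeomorphism of `G` with respect to `G'`: for every simple cycle `C` of `G` all of
whose edges lie in `G'`, the set of edges of `G` appearing an odd number of times in the
combined multiset of the walks assigned to the edges of `C` is exactly the edge set of
`C`. -/
def IsCycleHomeo {V : Type} [DecidableEq V] {G : SimpleGraph V} (G' : G.Subgraph)
    (Q : ∀ {a b : V}, G'.Adj a b → Multiset (Sym2 V)) : Prop :=
  ∀ (v : V) (c : G.Walk v v), c.IsCycle →
    ∀ hmem : ∀ e ∈ c.edges, e ∈ G'.edgeSet,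
      {e : Sym2 V | Odd ((combinedEdges Q c hmem).count e)} = {e : Sym2 V | e ∈ c.edges}

end Split

/-- `f̄ : V_{G'} → V_G × V_H` is an `(α, ε)`-split of the extension graph `X(G,H,M)`:
`G'` is a subgraph of `G` with at least `(1−ε)|E_G|` edges; there is a choice `P` of
shortest paths in `X` between the images under `f̄` of the endpoints of each edge of `G'`
whose projections to `G` make `(π ∘ f̄, P_{π∘f̄})` a cycle-homeomorphism of `G` with
respect to `G'`; `D_X(f̄(g₁), f̄(g₂)) < α` for every edge `(g₁,g₂)` of `G'`; and for every
`g ∈ V_{G'}` the shortest path in `G` between `g` and `π(f̄(g))` has at most `ε·log n`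
edges. -/
def IsSplit (n : ℕ) {VG VH : Type} [Fintype VG] [DecidableEq VG] [DecidableEq VH]
    (G : SimpleGraph VG) (H : SimpleGraph VH) (EG : Finset (VG × VG))
    (M : VG × VG → VH ≃ VH) (α ε : ℝ) (G' : G.Subgraph) (fbar : VG → VG × VH) : Prop :=
  (1 - ε) * (G.edgeSet.ncard : ℝ) ≤ (G'.edgeSet.ncard : ℝ) ∧
  (∃ P : ∀ {g₁ g₂ : VG}, G'.Adj g₁ g₂ → (ExtGraph H EG M).Walk (fbar g₁) (fbar g₂),
    (∀ {g₁ g₂ : VG} (hadj : G'.Adj g₁ g₂),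
      walkCost (extLen n) (P hadj) = extDist n H EG M (fbar g₁) (fbar g₂)) ∧
    IsCycleHomeo G' (fun {_ _} hadj => projEdges (P hadj))) ∧
  (∀ {g₁ g₂ : VG}, G'.Adj g₁ g₂ → extDist n H EG M (fbar g₁) (fbar g₂) < α) ∧
  ∀ g ∈ G'.verts, (G.dist g (fbar g).1 : ℝ) ≤ ε * Real.log n

/-- The cloud of a vertex of the instance graph (for a terminal `v_T`, the cloud of `v`). -/
def cloudOf {VG VH : Type} : IV VG VH → VG := fun v =>
  match v with
  | Sum.inl x => x.1
  | Sum.inr x => x.1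

/-- Edge lengths on the instance graph `𝒢` of `𝓘(X)`: every edge coming from `X` keeps
its length in `X` (`(log n)^{1/3}` intra-cloud, `(log n)^{2/3}` inter-cloud) and every
pendant edge `(v, v_T)` has length `L = log n`. -/
def instLen (n : ℕ) {VG VH : Type} [DecidableEq VG] : Sym2 (IV VG VH) → ℝ := fun e =>
  if (Sym2.map Sum.isLeft e).IsDiag then
    (if (Sym2.map cloudOf e).IsDiag then Real.log n ^ ((1 : ℝ) / 3)
      else Real.log n ^ ((2 : ℝ) / 3))
  else Real.log n

/-- The instance graph `𝒢` of `𝓘(X)`, whose edges are the elements of `instEdges`. -/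
def instGraph {VG VH : Type} [Fintype VG] [Fintype VH] [DecidableEq VG] [DecidableEq VH]
    (EH : Finset (VH × VH)) (EG : Finset (VG × VG)) (M : VG × VG → VH ≃ VH) :
    SimpleGraph (IV VG VH) :=
  SimpleGraph.fromRel fun a b => (a, b) ∈ instEdges EH EG M

/-- Markov's inequality for finite sums. -/
lemma mul_ncard_lt_le_sum {α : Type*} [Fintype α] (a : α → ℝ) (ha : ∀ x, 0 ≤ a x) (t : ℝ) :
    t * ({x | t < a x}.ncard : ℝ) ≤ ∑ x, a x := by
  classical
  have hcard : {x | t < a x}.ncard = (Finset.univ.filter fun x => t < a x).card := by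
    rw [← Set.ncard_coe_finset]
    simp
  rw [hcard, mul_comm, ← nsmul_eq_mul]
  refine (Finset.card_nsmul_le_sum _ a t fun x hx => (Finset.mem_filter.mp hx).2.le).trans ?_
  exact Finset.sum_le_sum_of_subset_of_nonneg (Finset.filter_subset _ _) fun x _ _ => ha x

/-- The ordered pairs of adjacent vertices to which `F` gives different labels. -/
def bichromatic {V α : Type} (H : SimpleGraph V) (F : V → α) : Set (V × V) :=
  {p | H.Adj p.1 p.2 ∧ F p.1 ≠ F p.2}

/-- A labelling of an expander with few bichromatic edges is nearly constant. -/
lemma exists_majority_label {V α : Type} [Fintype V] {H : SimpleGraph V} {h ε : ℝ}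
    (hh : 0 < h) (hε : 2 * ε < h) (hV : 0 < Fintype.card V) (hexp : EdgeExpansionAtLeast H h)
    (F : V → α) (hB : ((bichromatic H F).ncard : ℝ) ≤ ε * Fintype.card V) :
    ∃ v, (1 - 1 / h * ε) * (Fintype.card V : ℝ) ≤ ({x | F x = v}.ncard : ℝ) := by
  classical
  have hV' : (0 : ℝ) < Fintype.card V := by exact_mod_cast hV
  have hfin : ∀ v, {x | F x = v}.ncard = (Finset.univ.filter fun x => F x = v).card := by
    intro v
    rw [← Set.ncard_coe_finset]
    simp
  have hlarge : ∃ v, Fintype.card V < 2 * (Finset.univ.filter fun x => F x = v).card := by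
    by_contra! hsmall
    have hBf : (bichromatic H F).ncard
        = (Finset.univ.filter fun p : V × V => H.Adj p.1 p.2 ∧ F p.1 ≠ F p.2).card := by
      rw [← Set.ncard_coe_finset]
      simp [bichromatic]
    have hsumB : (bichromatic H F).ncard = ∑ v ∈ Finset.univ.image F,
        {p : V × V | H.Adj p.1 p.2 ∧ p.1 ∈ (Finset.univ.filter fun x => F x = v) ∧
          p.2 ∉ (Finset.univ.filter fun x => F x = v)}.ncard := by
      rw [hBf, Finset.card_eq_sum_card_fiberwise (f := fun p => F p.1) (t := Finset.univ.image F)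
        (fun p _ => by simp)]
      refine Finset.sum_congr rfl fun v _ => ?_
      rw [← Set.ncard_coe_finset]
      congr 1
      ext p
      simp only [Finset.coe_filter, Finset.mem_filter, Finset.mem_univ, true_and,
        Set.mem_ofPred_eq]
      constructor
      · rintro ⟨⟨h1, h2⟩, rfl⟩
        exact ⟨h1, rfl, fun h3 => h2 h3.symm⟩
      · rintro ⟨h1, rfl, h2⟩
        exact ⟨⟨h1, fun h3 => h2 h3.symm⟩, rfl⟩
    have hsumV : Fintype.card V = ∑ v ∈ Finset.univ.image F,
        (Finset.univ.filter fun x => F x = v).card := by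
      rw [← Finset.card_univ]
      exact Finset.card_eq_sum_card_fiberwise (fun p _ => by simp)
    have hle : h * Fintype.card V ≤ ((bichromatic H F).ncard : ℝ) := by
      rw [hsumB]
      conv_lhs => rw [hsumV]
      push_cast
      rw [Finset.mul_sum]
      exact Finset.sum_le_sum fun v _ => hexp _ (hsmall v)
    nlinarith
  obtain ⟨v, hv⟩ := hlarge
  refine ⟨v, ?_⟩
  have hadd := Finset.card_add_card_compl (Finset.univ.filter fun x => F x = v)
  have hbd := hexp (Finset.univ.filter fun x => F x = v)ᶜ (by omega)
  have hsub : {p : V × V | H.Adj p.1 p.2 ∧ p.1 ∈ (Finset.univ.filter fun x => F x = v)ᶜ ∧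
      p.2 ∉ (Finset.univ.filter fun x => F x = v)ᶜ} ⊆ bichromatic H F := by
    rintro p ⟨h1, h2, h3⟩
    simp only [Finset.compl_filter, Finset.mem_filter, Finset.mem_univ, true_and, not_not]
      at h2 h3
    exact ⟨h1, fun h4 => h2 (h4.trans h3)⟩
  have hcard : (({p : V × V | H.Adj p.1 p.2 ∧ p.1 ∈ (Finset.univ.filter fun x => F x = v)ᶜ ∧
      p.2 ∉ (Finset.univ.filter fun x => F x = v)ᶜ}.ncard : ℕ) : ℝ)
        ≤ ((bichromatic H F).ncard : ℝ) := by
    exact_mod_cast Set.ncard_le_ncard hsub (Set.toFinite _)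
  have haddR : ((Finset.univ.filter fun x => F x = v).card : ℝ)
      + ((Finset.univ.filter fun x => F x = v)ᶜ.card : ℝ) = Fintype.card V := by
    exact_mod_cast hadd
  rw [hfin]
  have hcompl : ((Finset.univ.filter fun x => F x = v)ᶜ.card : ℝ)
      ≤ ε * Fintype.card V / h := by
    rw [le_div_iff₀ hh]
    linarith
  have hring : (1 - 1 / h * ε) * (Fintype.card V : ℝ)
      = Fintype.card V - ε * Fintype.card V / h := by ring
  linarith

/-- Every bichromatic pair is, up to reversal, an oriented bichromatic edge. -/
lemma ncard_bichromatic_le {V α : Type} [Fintype V] [DecidableEq α] {H : SimpleGraph V}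
    {EH : Finset (V × V)} (hEH : IsOrientation H EH) (F : V → α) :
    (bichromatic H F).ncard ≤ 2 * (EH.filter fun p => F p.1 ≠ F p.2).card := by
  classical
  set C := EH.filter fun p => F p.1 ≠ F p.2 with hC
  have hsub : bichromatic H F ⊆ ((C ∪ C.image Prod.swap : Finset (V × V)) : Set (V × V)) := by
    rintro ⟨a, b⟩ ⟨hadj, hne⟩
    by_cases hab : (a, b) ∈ EH
    · exact Finset.mem_coe.2 (Finset.mem_union_left _ (Finset.mem_filter.2 ⟨hab, hne⟩))
    · have hba : (b, a) ∈ EH := (hEH.2 b a hadj.symm).2 hab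
      exact Finset.mem_coe.2 (Finset.mem_union_right _ (Finset.mem_image.2
        ⟨(b, a), Finset.mem_filter.2 ⟨hba, hne.symm⟩, rfl⟩))
  calc (bichromatic H F).ncard
      ≤ (C ∪ C.image Prod.swap).card := by
        rw [← Set.ncard_coe_finset]
        exact Set.ncard_le_ncard hsub (Finset.finite_toSet _)
    _ ≤ C.card + (C.image Prod.swap).card := Finset.card_union_le _ _
    _ ≤ 2 * C.card := by
        have := Finset.card_image_le (s := C) (f := Prod.swap)
        omega

lemma extLen_nonneg {n : ℕ} [DecidableEq VG] (e : Sym2 (VG × VH)) : 0 ≤ extLen n e := by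
  have := Real.log_natCast_nonneg n
  unfold extLen
  split_ifs <;> positivity

/-- The projection to `G` of a walk of the extension graph is not longer, up to the length
of the inter-cloud edges. -/
lemma dist_le_walkCost {n : ℕ} [DecidableEq VG] {G : SimpleGraph VG} (hG : G.Connected)
    {H : SimpleGraph VH} {EG : Finset (VG × VG)} (hEG : IsOrientation G EG)
    {M : VG × VG → VH ≃ VH} {u v : VG × VH} (p : (ExtGraph H EG M).Walk u v) :
    Real.log n ^ ((2 : ℝ) / 3) * G.dist u.1 v.1 ≤ walkCost (extLen n) p := by
  have hL := Real.log_natCast_nonneg n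
  have hpow : 0 ≤ Real.log n ^ ((2 : ℝ) / 3) := by positivity
  induction p with
  | nil => simp [walkCost]
  | @cons u w v hadj p ih =>
    have hcost : walkCost (extLen n) (SimpleGraph.Walk.cons hadj p)
        = extLen n s(u, w) + walkCost (extLen n) p := by
      simp [walkCost]
    rw [hcost]
    by_cases huw : u.1 = w.1
    · have := extLen_nonneg (n := n) s(u, w)
      rw [huw]
      linarith
    · have hGadj : G.Adj u.1 w.1 := by
        rcases hadj with ⟨-, (⟨h1, -⟩ | ⟨h1, -⟩) | (⟨h1, -⟩ | ⟨h1, -⟩)⟩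
        · exact absurd h1 huw
        · exact hEG.1 _ h1
        · exact absurd h1.symm huw
        · exact (hEG.1 _ h1).symm
      have hlen : extLen n s(u, w) = Real.log n ^ ((2 : ℝ) / 3) := by
        simp [extLen, huw]
      have htri : (G.dist u.1 v.1 : ℝ) ≤ 1 + G.dist w.1 v.1 := by
        have := hG.dist_triangle (u := u.1) (v := w.1) (w := v.1)
        rw [SimpleGraph.dist_eq_one_iff_adj.2 hGadj] at this
        exact_mod_cast this
      rw [hlen]
      nlinarith

/-- The extension graph of connected graphs is connected. -/
lemma extGraph_reachable {G : SimpleGraph VG} (hG : G.Connected)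
    {H : SimpleGraph VH} (hH : H.Connected) {EG : Finset (VG × VG)}
    (hEG : IsOrientation G EG) (M : VG × VG → VH ≃ VH) (u v : VG × VH) :
    (ExtGraph H EG M).Reachable u v := by
  have hcloud : ∀ g x y, (ExtGraph H EG M).Reachable (g, x) (g, y) := by
    intro g x y
    obtain ⟨p⟩ := hH.preconnected x y
    induction p with
    | nil => exact SimpleGraph.Reachable.refl _
    | cons hadj p ih =>
      refine SimpleGraph.Reachable.trans (SimpleGraph.Adj.reachable ?_) ih
      refine ⟨fun he => hadj.ne (congrArg Prod.snd he), Or.inl (Or.inl ⟨rfl, hadj⟩)⟩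
  have hall : ∀ g g' : VG, ∀ x y, (ExtGraph H EG M).Reachable (g, x) (g', y) := by
    intro g g' x y
    obtain ⟨p⟩ := hG.preconnected g g'
    induction p generalizing x with
    | nil => exact hcloud _ _ _
    | @cons a b _ hadj p ih =>
      by_cases hab : (a, b) ∈ EG
      · refine SimpleGraph.Reachable.trans (SimpleGraph.Adj.reachable ?_) (ih (M (a, b) x))
        exact ⟨fun he => hadj.ne (congrArg Prod.fst he), Or.inl (Or.inr ⟨hab, rfl⟩)⟩
      · have hba : (b, a) ∈ EG := (hEG.2 b a hadj.symm).2 hab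
        refine SimpleGraph.Reachable.trans (SimpleGraph.Adj.reachable ?_)
          (ih ((M (b, a)).symm x))
        exact ⟨fun he => hadj.ne (congrArg Prod.fst he), Or.inr (Or.inr ⟨hba, by simp⟩)⟩
  exact hall u.1 v.1 u.2 v.2

lemma dist_le_extDist {n : ℕ} [DecidableEq VG] {G : SimpleGraph VG} (hG : G.Connected)
    {H : SimpleGraph VH} (hH : H.Connected) {EG : Finset (VG × VG)}
    (hEG : IsOrientation G EG) (M : VG × VG → VH ≃ VH) (u v : VG × VH) :
    Real.log n ^ ((2 : ℝ) / 3) * G.dist u.1 v.1 ≤ extDist n H EG M u v := by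
  obtain ⟨p⟩ := extGraph_reachable hG hH hEG M u v
  refine le_csInf ⟨_, p, rfl⟩ ?_
  rintro r ⟨q, rfl⟩
  exact dist_le_walkCost hG hEG q

lemma extDist_nonneg {n : ℕ} [DecidableEq VG] {H : SimpleGraph VH} {EG : Finset (VG × VG)}
    {M : VG × VG → VH ≃ VH} (u v : VG × VH) : 0 ≤ extDist n H EG M u v := by
  refine Real.sInf_nonneg ?_
  rintro r ⟨q, rfl⟩
  refine List.sum_nonneg fun x hx => ?_
  obtain ⟨e, -, rfl⟩ := List.mem_map.1 hx
  exact extLen_nonneg e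

lemma instD_nonneg {n : ℕ} [DecidableEq VG] [DecidableEq VH] {H : SimpleGraph VH}
    {EG : Finset (VG × VG)} {M : VG × VG → VH ≃ VH} (a b : IV VG VH) :
    0 ≤ instD n H EG M a b := by
  have hL := Real.log_natCast_nonneg n
  rcases a with a | a <;> rcases b with b | b <;> simp only [instD, le_refl]
  split_ifs
  · exact le_rfl
  · have := extDist_nonneg (n := n) (H := H) (EG := EG) (M := M) a b
    linarith

lemma instW_nonneg {n : ℕ} [DecidableEq VG] (p : IV VG VH × IV VG VH) : 0 ≤ instW n p := by
  have hL := Real.log_natCast_nonneg n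
  rcases p with ⟨a | a, b | b⟩ <;> simp only [instW, le_refl]
  · split_ifs <;> positivity
  · positivity

/-- The intra-cloud edges bound the number of bichromatic pairs in the clouds. -/
lemma sum_ncard_bichromatic_le_intCost {n : ℕ} [Fintype VG] [Fintype VH] [DecidableEq VG]
    [DecidableEq VH] (hn : 0 < Real.log n) {H : SimpleGraph VH} {EH : Finset (VH × VH)}
    (hEH : IsOrientation H EH) {EG : Finset (VG × VG)} {M : VG × VG → VH ≃ VH}
    {f : IV VG VH → IV VG VH} {F : VG × VH → VG × VH}
    (hF : ∀ x, f (Sum.inl x) = Sum.inr (F x)) :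
    Real.log n ^ ((2 : ℝ) / 3) * ∑ g, ((bichromatic H fun x => F (g, x)).ncard : ℝ)
      ≤ intCost n H EH EG M f := by
  have hpow : Real.log n ^ ((2 : ℝ) / 3) * Real.log n ^ ((1 : ℝ) / 3) = Real.log n := by
    rw [← Real.rpow_add hn]
    norm_num
  have hpos : 0 < Real.log n ^ ((1 : ℝ) / 3) := by positivity
  have hpos2 : 0 < Real.log n ^ ((2 : ℝ) / 3) := by positivity
  have hsub : ((Finset.univ ×ˢ EH).image fun p : VG × (VH × VH) =>
      ((Sum.inl (p.1, p.2.1), Sum.inl (p.1, p.2.2)) : IV VG VH × IV VG VH))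
        ⊆ instEdges EH EG M :=
    Finset.subset_union_left.trans Finset.subset_union_left
  have hinj : Function.Injective fun p : VG × (VH × VH) =>
      ((Sum.inl (p.1, p.2.1), Sum.inl (p.1, p.2.2)) : IV VG VH × IV VG VH) := by
    rintro ⟨a, b, c⟩ ⟨a', b', c'⟩ he
    simp only [Prod.mk.injEq, Sum.inl.injEq] at he ⊢
    exact ⟨he.1.1, he.1.2, he.2.2⟩
  refine le_trans ?_ (Finset.sum_le_sum_of_subset_of_nonneg hsub
    fun p _ _ => mul_nonneg (instW_nonneg p) (instD_nonneg _ _))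
  rw [Finset.sum_image hinj.injOn, Finset.sum_product, Finset.mul_sum]
  refine Finset.sum_le_sum fun g _ => ?_
  have hcut : ((bichromatic H fun x => F (g, x)).ncard : ℝ)
      ≤ 2 * ((EH.filter fun p => F (g, p.1) ≠ F (g, p.2)).card : ℝ) := by
    exact_mod_cast ncard_bichromatic_le hEH fun x => F (g, x)
  calc Real.log n ^ ((2 : ℝ) / 3) * ((bichromatic H fun x => F (g, x)).ncard : ℝ)
      ≤ Real.log n ^ ((2 : ℝ) / 3)
          * (2 * ((EH.filter fun p => F (g, p.1) ≠ F (g, p.2)).card : ℝ)) := by gcongr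
    _ = ∑ p ∈ EH.filter fun p => F (g, p.1) ≠ F (g, p.2),
          2 * Real.log n ^ ((2 : ℝ) / 3) := by
        rw [Finset.sum_const, nsmul_eq_mul]
        ring
    _ = ∑ p ∈ EH, if F (g, p.1) ≠ F (g, p.2) then 2 * Real.log n ^ ((2 : ℝ) / 3) else 0 :=
        Finset.sum_filter _ _
    _ ≤ _ := by
        refine Finset.sum_le_sum fun p _ => ?_
        split_ifs with hp
        · have := extDist_nonneg (n := n) (H := H) (EG := EG) (M := M) (F (g, p.1)) (F (g, p.2))
          simp only [instW, hF, instD, if_true, if_neg hp]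
          rw [inv_mul_eq_div, le_div_iff₀ hpos]
          linarith
        · exact mul_nonneg (instW_nonneg _) (instD_nonneg _ _)

/-- The pendant edges bound the displacement of the clouds in `G`. -/
lemma sum_dist_le_intCost {n : ℕ} [Fintype VG] [Fintype VH] [DecidableEq VG]
    [DecidableEq VH] (hn : 0 < Real.log n) {G : SimpleGraph VG} (hG : G.Connected)
    {H : SimpleGraph VH} (hH : H.Connected) {EH : Finset (VH × VH)}
    {EG : Finset (VG × VG)} (hEG : IsOrientation G EG) {M : VG × VG → VH ≃ VH}
    {f : IV VG VH → IV VG VH} (hfix : ∀ x, f (Sum.inr x) = Sum.inr x)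
    {F : VG × VH → VG × VH} (hF : ∀ x, f (Sum.inl x) = Sum.inr (F x)) :
    Real.log n ^ ((2 : ℝ) / 3) * ∑ g, ∑ x, (G.dist g (F (g, x)).1 : ℝ)
      ≤ Real.log n * intCost n H EH EG M f := by
  have hsub : ((Finset.univ : Finset (VG × VH)).image fun x =>
      ((Sum.inl x, Sum.inr x) : IV VG VH × IV VG VH)) ⊆ instEdges EH EG M :=
    Finset.subset_union_right
  have hinj : Function.Injective fun x : VG × VH =>
      ((Sum.inl x, Sum.inr x) : IV VG VH × IV VG VH) := by
    intro x y he
    simpa using he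
  have hle := Finset.sum_le_sum_of_subset_of_nonneg (f := fun p =>
    instW n p * instD n H EG M (f p.1) (f p.2)) hsub
      fun p _ _ => mul_nonneg (instW_nonneg p) (instD_nonneg _ _)
  rw [Finset.sum_image hinj.injOn] at hle
  refine le_trans ?_ (mul_le_mul_of_nonneg_left hle hn.le)
  rw [← Fintype.sum_prod_type' (fun g x => (G.dist g (F (g, x)).1 : ℝ)), Finset.mul_sum,
    Finset.mul_sum]
  refine Finset.sum_le_sum fun x _ => ?_
  simp only [instW, hF, hfix]
  rw [mul_inv_cancel_left₀ hn.ne']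
  by_cases hx : F x = x
  · simp [hx, instD]
  · have := dist_le_extDist (n := n) hG hH hEG M (F x) x
    rw [SimpleGraph.dist_comm] at this
    simp only [instD, if_neg hx]
    linarith

/-- Most clouds have a nearby representative: for `d ≥ 3` and `h, γ > 0` there are
constants `C₁, C₂ > 0` and `ε₀ > 0` (depending only on `d, h, γ`) such that for every
`ε ∈ (0, ε₀)`, every `c ∈ (0, 1]`, every sufficiently large `n`, every pair `(G, H)`
satisfying the hypotheses, every orientation, every family `M`, and every integral
solution `f` of cost at most `c·ε²·n²·(log n)^{2/3}`, the number of good clouds — clouds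
`g` for which some `v ∈ X` satisfies `|{h : f(g,h) = v_T}| ≥ (1 − C₁·ε)·|V_H|` and the
shortest path in `G` between `g` and `π(v)` has at most `ε·log n` edges — is at least
`(1 − C₂·c·ε)·n`. -/
theorem most_clouds_have_representatives (d : ℕ) (hd : 3 ≤ d) (h γ : ℝ) (hh : 0 < h)
    (hγ : 0 < γ) :
    ∃ C₁ C₂ ε₀ : ℝ, 0 < C₁ ∧ 0 < C₂ ∧ 0 < ε₀ ∧
      ∀ ε : ℝ, 0 < ε → ε < ε₀ → ∀ c : ℝ, 0 < c → c ≤ 1 →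
      ∃ N : ℕ, ∀ n : ℕ, N ≤ n →
        ∀ (VG VH : Type) [Fintype VG] [Fintype VH] [DecidableEq VG] [DecidableEq VH]
          [Group VG] [Group VH] (G : SimpleGraph VG) (H : SimpleGraph VH),
          GoodPair d h γ n G H →
          ∀ EG : Finset (VG × VG), IsOrientation G EG →
          ∀ EH : Finset (VH × VH), IsOrientation H EH →
          ∀ M : VG × VG → VH ≃ VH,
          ∀ f : IV VG VH → IV VG VH, IsIntegralSolution f →
            intCost n H EH EG M f ≤ c * ε ^ 2 * (n : ℝ) ^ 2 * Real.log n ^ ((2 : ℝ) / 3) →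
            (1 - C₂ * c * ε) * (n : ℝ) ≤
              (({g : VG | ∃ v : VG × VH,
                  (1 - C₁ * ε) * (Fintype.card VH : ℝ) ≤
                    (({x : VH | f (Sum.inl (g, x)) = Sum.inr v}.ncard : ℕ) : ℝ) ∧
                  (G.dist g v.1 : ℝ) ≤ ε * Real.log n}.ncard : ℕ) : ℝ) := by
  refine ⟨1 / h, 3, h / 2, by positivity, by norm_num, by positivity, ?_⟩
  intro ε hε hεh c hc _
  refine ⟨3, ?_⟩
  intro n hn VG VH _ _ _ _ _ _ G H hGH EG hEG EH hEH M f hf hcost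
  obtain ⟨hcG, hcH, hG, hH, -, -, -, -, -, hexp, -, -⟩ := hGH
  have hn3 : (3 : ℝ) ≤ n := by exact_mod_cast hn
  have hL : 0 < Real.log n := Real.log_pos (by linarith)
  have hpow : 0 < Real.log n ^ ((2 : ℝ) / 3) := by positivity
  choose F₀ hF₀ using hf.1
  set F : VG × VH → VG × VH := fun x => F₀ (Sum.inl x) with hFdef
  have hF : ∀ x, f (Sum.inl x) = Sum.inr (F x) := fun x => hF₀ _
  have hbi : ∑ g, ((bichromatic H fun x => F (g, x)).ncard : ℝ) ≤ c * ε ^ 2 * (n : ℝ) ^ 2 := by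
    have := (sum_ncard_bichromatic_le_intCost hL hEH (EG := EG) (M := M) hF).trans hcost
    refine le_of_mul_le_mul_left (this.trans_eq ?_) hpow
    ring
  have hdist : ∑ g, ∑ x, (G.dist g (F (g, x)).1 : ℝ)
      ≤ c * ε ^ 2 * (n : ℝ) ^ 2 * Real.log n := by
    have := (sum_dist_le_intCost hL hG hH (EH := EH) hEG (M := M) hf.2 hF).trans
      (mul_le_mul_of_nonneg_left hcost hL.le)
    refine le_of_mul_le_mul_left (this.trans_eq ?_) hpow
    ring
  set B₁ : Set VG := {g | ε * n < ((bichromatic H fun x => F (g, x)).ncard : ℝ)} with hB₁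
  set B₂ : Set VG := {g | ε * n * Real.log n / 2 < ∑ x, (G.dist g (F (g, x)).1 : ℝ)} with hB₂
  set A : Set VG := {g : VG | ∃ v : VG × VH,
      (1 - 1 / h * ε) * (Fintype.card VH : ℝ) ≤
        (({x : VH | f (Sum.inl (g, x)) = Sum.inr v}.ncard : ℕ) : ℝ) ∧
      (G.dist g v.1 : ℝ) ≤ ε * Real.log n} with hA
  have hB₁card : (B₁.ncard : ℝ) ≤ c * ε * n := by
    have := (mul_ncard_lt_le_sum (fun g => ((bichromatic H fun x => F (g, x)).ncard : ℝ))
      (fun g => by positivity) (ε * n)).trans hbi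
    refine le_of_mul_le_mul_left (this.trans_eq ?_) (by positivity : 0 < ε * n)
    ring
  have hB₂card : (B₂.ncard : ℝ) ≤ 2 * c * ε * n := by
    have := (mul_ncard_lt_le_sum (fun g => ∑ x, (G.dist g (F (g, x)).1 : ℝ))
      (fun g => by positivity) (ε * n * Real.log n / 2)).trans hdist
    refine le_of_mul_le_mul_left (this.trans_eq ?_)
      (by positivity : 0 < ε * n * Real.log n / 2)
    ring
  have hcover : (Set.univ : Set VG) ⊆ A ∪ (B₁ ∪ B₂) := by
    intro g _
    by_contra hg
    simp only [Set.mem_union, not_or] at hg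
    obtain ⟨hgA, hg₁, hg₂⟩ := hg
    simp only [hB₁, hB₂, Set.mem_ofPred_eq, not_lt] at hg₁ hg₂
    obtain ⟨v, hv⟩ := exists_majority_label hh (by linarith : 2 * ε < h) (by omega) hexp
      (fun x => F (g, x)) (by rw [hcH]; exact hg₁)
    refine hgA ⟨v, by simpa [hF] using hv, ?_⟩
    by_contra! hfar
    have hhalf : (n : ℝ) / 2 < ({x | F (g, x) = v}.ncard : ℝ) := by
      refine lt_of_lt_of_le ?_ hv
      have : 1 / h * ε < 1 / 2 := by
        rw [one_div_mul_eq_div, div_lt_iff₀ hh]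
        linarith
      rw [hcH]
      nlinarith
    have hmarkov := mul_ncard_lt_le_sum (fun x => (G.dist g (F (g, x)).1 : ℝ))
      (fun x => by positivity) (ε * Real.log n)
    have hsub : ({x | F (g, x) = v}.ncard : ℝ)
        ≤ ({x | ε * Real.log n < (G.dist g (F (g, x)).1 : ℝ)}.ncard : ℝ) := by
      refine Nat.cast_le.2 (Set.ncard_le_ncard ?_ (Set.toFinite _))
      intro x hx
      simp only [Set.mem_ofPred_eq] at hx ⊢
      rw [hx]
      exact hfar
    have hεL : 0 < ε * Real.log n := by positivity
    nlinarith
  have hcount : (n : ℝ) ≤ A.ncard + (B₁.ncard + B₂.ncard) := by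
    have h1 := Set.ncard_le_ncard hcover (Set.toFinite _)
    have h2 := Set.ncard_union_le A (B₁ ∪ B₂)
    have h3 := Set.ncard_union_le B₁ B₂
    rw [Set.ncard_univ, Nat.card_eq_fintype_card, hcG] at h1
    exact_mod_cast (by omega : n ≤ A.ncard + (B₁.ncard + B₂.ncard))
  linarith
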